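/- For all natural numbers m, k, n ≥ 1 and d ≥ 1, one has the identity of R-linear endomorphisms of R[t]: (ad(−P_{n,0}))^d(P_{m,k}) = Σ_{i≥d} (−1)^{i−d} · i! · C(k,i) · A_d(i,n) · h^i · P_{m+nd−i, k−i}, where (ad X)(Y) = X∘Y − Y∘X and the sum is finite (terms vanish unless d ≤ i ≤ min(k, nd)). Note P_{n,0} is multiplication by t^n. This is the second iterated-adjoint formula in the proof of Lemma 3.1 (div-sum-lem(ii)) realized concretely. -/

import Mathlib

open Polynomial

/-- `E = h·D`, the `R`-linear endomorphism `f ↦ h · D f` of `R[t]`,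
where `D` is the formal derivative. -/
noncomputable def Eop (R : Type*) [CommRing R] (h : R) : Module.End R (Polynomial R) :=
  (LinearMap.mulLeft R (C h)).comp Polynomial.derivative

/-- `P_{m,k}(f) = E^k (t^m · f)`. -/
noncomputable def Pop (R : Type*) [CommRing R] (h : R) (m k : ℕ) :
    Module.End R (Polynomial R) :=
  (Eop R h ^ k).comp (LinearMap.mulLeft R (X ^ m))

/-- `A_d(i,n) = Σ_{i₁+⋯+i_d = i, each i_s ≥ 1} C(n,i₁)⋯C(n,i_d)`. -/
def Acoef (d i n : ℕ) : ℕ :=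
  ∑ f ∈ (Finset.Nat.antidiagonalTuple d i).filter (fun f => ∀ s, 1 ≤ f s),
    ∏ s, n.choose (f s)

theorem pascal_sum {M : Type*} [AddCommGroup M] (T : ℕ → M) (k : ℕ) :
    ∑ j ∈ Finset.range (k + 1), k.choose j • (T j + T (j + 1)) =
      ∑ j ∈ Finset.range (k + 2), (k + 1).choose j • T j := by
  rw [Finset.sum_range_succ' _ (k + 1)]
  simp only [Nat.choose_succ_succ, add_smul, smul_add, Finset.sum_add_distrib]
  rw [Finset.sum_range_succ (fun j => k.choose (j + 1) • T (j + 1)) k,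
    Finset.sum_range_succ' (fun j => k.choose j • T j) k]
  simp
  abel

theorem Eop_X_pow_mul (R : Type*) [CommRing R] (h : R) (n : ℕ) (g : R[X]) :
    X ^ n * Eop R h g = Eop R h (X ^ n * g) - (n : ℤ) • h • (X ^ (n - 1) * g) := by
  simp only [Eop, LinearMap.comp_apply, LinearMap.mulLeft_apply, derivative_mul,
    derivative_X_pow, zsmul_eq_mul, smul_eq_C_mul]
  simp
  ring

theorem X_pow_mul_Eop_pow (R : Type*) [CommRing R] (h : R) (n k : ℕ) (g : R[X]) :
    X ^ n * (Eop R h ^ k) g = ∑ j ∈ Finset.range (k + 1),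
      k.choose j • (((-1 : ℤ) ^ j * (n.descFactorial j : ℤ)) • h ^ j •
        (Eop R h ^ (k - j)) (X ^ (n - j) * g)) := by
  induction k generalizing g with
  | zero => simp
  | succ k ih =>
    rw [pow_succ, Module.End.mul_apply, ih, ← pascal_sum]
    apply Finset.sum_congr rfl
    intro j hj
    have hj' : j ≤ k := by simpa [Nat.lt_succ_iff] using hj
    congr 1
    rw [Eop_X_pow_mul, map_sub, ← Module.End.mul_apply, ← pow_succ,
      show k - j + 1 = k + 1 - j by omega, show k + 1 - (j + 1) = k - j by omega,
      map_zsmul, map_smul, smul_sub, smul_sub, sub_eq_add_neg, Nat.sub_sub]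
    congr 1
    rw [smul_comm (h ^ j) ((n - j : ℕ) : ℤ), smul_smul, smul_smul, ← pow_succ, ← neg_smul]
    congr 1
    rw [Nat.descFactorial_succ]
    push_cast
    ring

/-- the `d = 1` coefficient -/
def Bco (n j : ℕ) : ℕ := if 1 ≤ j then n.choose j else 0

theorem Acoef_zero (i n : ℕ) : Acoef 0 i n = if i = 0 then 1 else 0 := by
  cases i <;> simp [Acoef]

theorem Acoef_eq (d i n : ℕ) :
    Acoef d i n = ∑ f ∈ Finset.Nat.antidiagonalTuple d i, ∏ s, Bco n (f s) := by
  unfold Acoef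
  rw [Finset.sum_filter]
  apply Finset.sum_congr rfl
  intro f _
  split_ifs with hf
  · apply Finset.prod_congr rfl
    intro s _
    simp [Bco, hf s]
  · push Not at hf
    obtain ⟨s, hs⟩ := hf
    symm
    apply Finset.prod_eq_zero (Finset.mem_univ s)
    simp [Bco]
    omega

theorem Acoef_succ (d i n : ℕ) :
    Acoef (d + 1) i n = ∑ p ∈ Finset.HasAntidiagonal.antidiagonal i, Bco n p.1 * Acoef d p.2 n := by
  simp only [Acoef_eq, Finset.mul_sum]
  rw [Finset.sum_sigma']
  refine Finset.sum_bij' (fun f _ => ⟨(f 0, ∑ s, Fin.tail f s), Fin.tail f⟩)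
    (fun x _ => Fin.cons x.1.1 x.2) ?_ ?_ ?_ ?_ ?_
  · intro f hf
    simpa [Finset.Nat.mem_antidiagonalTuple, Fin.sum_univ_succ, Fin.tail] using hf
  · rintro ⟨⟨a, b⟩, f⟩ hf
    simp [Finset.Nat.mem_antidiagonalTuple] at hf
    simp [Finset.Nat.mem_antidiagonalTuple, Fin.sum_univ_succ, hf]
  · intro f hf
    simp
  · rintro ⟨⟨a, b⟩, f⟩ hf
    simp [Finset.Nat.mem_antidiagonalTuple] at hf
    simp [hf]
  · intro f hf
    simp [Fin.prod_univ_succ, Fin.tail]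

theorem Acoef_lt (d i n : ℕ) (hi : i < d) : Acoef d i n = 0 := by
  induction d generalizing i with
  | zero => omega
  | succ d ih =>
    rw [Acoef_succ]
    apply Finset.sum_eq_zero
    rintro ⟨a, b⟩ hp
    rw [Finset.HasAntidiagonal.mem_antidiagonal] at hp
    simp only at hp
    by_cases ha : 1 ≤ a
    · rw [ih b (by omega), mul_zero]
    · simp [Bco, ha]

theorem Acoef_gt (d i n : ℕ) (hi : n * d < i) : Acoef d i n = 0 := by
  induction d generalizing i with
  | zero => rw [Acoef_zero, if_neg (by omega)]
  | succ d ih =>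
    rw [Acoef_succ]
    apply Finset.sum_eq_zero
    rintro ⟨a, b⟩ hp
    rw [Finset.HasAntidiagonal.mem_antidiagonal] at hp
    simp only at hp
    rw [Nat.mul_succ] at hi
    by_cases ha : n < a
    · simp [Bco, Nat.choose_eq_zero_of_lt ha]
    · rw [ih b (by omega), mul_zero]

/-- the adjoint operator -/
noncomputable def adm (R : Type*) [CommRing R] (h : R) (n : ℕ) :
    Module.End R (Polynomial R) →ₗ[R] Module.End R (Polynomial R) :=
  LinearMap.mulLeft R (-Pop R h n 0) - LinearMap.mulRight R (-Pop R h n 0)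

theorem adm_Pop (R : Type*) [CommRing R] (h : R) (m k n : ℕ) :
    adm R h n (Pop R h m k) = ∑ j ∈ Finset.range (k + 1),
      ((-1 : ℤ) ^ (j + 1) * (j.factorial : ℤ) * (k.choose j : ℤ) * (Bco n j : ℤ)) •
        (h ^ j • Pop R h (m + n - j) (k - j)) := by
  apply LinearMap.ext
  intro g
  have e : adm R h n (Pop R h m k) g =
      (Eop R h ^ k) (X ^ (m + n) * g) - X ^ n * (Eop R h ^ k) (X ^ m * g) := by
    simp [adm, Pop, pow_add, mul_assoc]
    abel
  rw [e, X_pow_mul_Eop_pow, Finset.sum_range_succ', Finset.sum_range_succ']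
  simp only [LinearMap.add_apply, LinearMap.sum_apply, LinearMap.smul_apply]
  simp only [Bco]
  simp only [Nat.choose_zero_right, one_smul, pow_zero, Nat.descFactorial_zero, Nat.cast_one,
    mul_one, Nat.sub_zero, ← mul_assoc, ← pow_add, add_comm n m]
  simp only [nonpos_iff_eq_zero, one_ne_zero, if_false, Nat.cast_zero, mul_zero, zero_smul,
    add_zero, sub_add_cancel_right]
  rw [← Finset.sum_neg_distrib]
  apply Finset.sum_congr rfl
  intro j _
  rw [if_pos (by omega)]
  by_cases hj : n < j + 1
  · rw [Nat.choose_eq_zero_of_lt hj, Nat.descFactorial_eq_zero_iff_lt.2 hj]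
    simp
  · rw [← natCast_zsmul, smul_smul, ← neg_smul, Nat.descFactorial_eq_factorial_mul_choose]
    congr 1
    · push_cast; ring
    · simp only [Pop, LinearMap.comp_apply, LinearMap.mulLeft_apply]
      rw [show n - (j+1) + m = m + n - (j+1) by omega]

theorem tri_sum {M : Type*} [AddCommGroup M] (F : ℕ → ℕ → M) (k : ℕ) :
    ∑ i ∈ Finset.range (k + 1), ∑ j ∈ Finset.range (k - i + 1), F j i =
      ∑ l ∈ Finset.range (k + 1), ∑ p ∈ Finset.HasAntidiagonal.antidiagonal l, F p.1 p.2 := by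
  rw [Finset.sum_sigma', Finset.sum_sigma']
  refine Finset.sum_bij' (fun x _ => ⟨x.1 + x.2, (x.2, x.1)⟩)
    (fun x _ => ⟨x.2.2, x.2.1⟩) ?_ ?_ ?_ ?_ ?_
  · rintro ⟨i, j⟩ hx
    simp at hx ⊢
    omega
  · rintro ⟨l, ⟨a, b⟩⟩ hx
    simp at hx ⊢
    omega
  · rintro ⟨i, j⟩ hx
    simp
  · rintro ⟨l, ⟨a, b⟩⟩ hx
    simp at hx
    obtain ⟨_, rfl⟩ := hx
    simp [add_comm]
  · rintro ⟨i, j⟩ hx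
    simp

theorem fact_choose (k a b : ℕ) (hk : a + b ≤ k) :
    (b.factorial * k.choose b) * (a.factorial * (k - b).choose a) =
      (a + b).factorial * k.choose (a + b) := by
  simp only [← Nat.descFactorial_eq_factorial_mul_choose]
  have := Nat.descFactorial_mul_descFactorial (n := k) (show b ≤ a + b by omega)
  rw [Nat.add_sub_cancel] at this
  rw [← this, mul_comm]

theorem adm_iter (R : Type*) [CommRing R] (h : R) (m k n d : ℕ) :
    (adm R h n)^[d] (Pop R h m k) = ∑ i ∈ Finset.range (k + 1),
      ((-1 : ℤ) ^ (i + d) * (i.factorial : ℤ) * (k.choose i : ℤ) * (Acoef d i n : ℤ)) •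
        (h ^ i • Pop R h (m + n * d - i) (k - i)) := by
  induction d with
  | zero =>
    rw [Finset.sum_range_succ']
    simp [Acoef_zero]
  | succ d ih =>
    rw [Function.iterate_succ_apply', ih, map_sum]
    simp only [map_zsmul, map_smul, adm_Pop, Finset.smul_sum]
    rw [tri_sum (fun j i => ((-1 : ℤ) ^ (i + d) * (i.factorial : ℤ) * (k.choose i : ℤ) *
      (Acoef d i n : ℤ)) • h ^ i • ((-1 : ℤ) ^ (j + 1) * (j.factorial : ℤ) *
      ((k - i).choose j : ℤ) * (Bco n j : ℤ)) •
        (h ^ j • Pop R h (m + n * d - i + n - j) (k - i - j)))]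
    apply Finset.sum_congr rfl
    intro l hl
    rw [Acoef_succ, Nat.cast_sum, Finset.mul_sum, Finset.sum_smul]
    apply Finset.sum_congr rfl
    rintro ⟨a, b⟩ hp
    rw [Finset.HasAntidiagonal.mem_antidiagonal] at hp
    simp only at hp ⊢
    subst hp
    have hk : a + b ≤ k := by simpa [Nat.lt_succ_iff] using hl
    by_cases hb : n * d < b
    · simp [Acoef_gt d b n hb]
    rw [smul_comm (h ^ b), smul_smul, smul_smul, ← pow_add]
    congr 1
    · have := fact_choose k a b hk
      zify at this
      push_cast
      linear_combination ((-1 : ℤ) ^ (a + b + (d + 1)) * (Acoef d b n : ℤ) * (Bco n a : ℤ)) * this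
    · rw [add_comm b a, Nat.sub_sub k, add_comm b a, Nat.mul_succ]
      congr 2
      omega


/-- The second iterated-adjoint formula in the proof of Lemma 3.1 (div-sum-lem(ii))
realized concretely on `R[t]`:
`(ad(−P_{n,0}))^d(P_{m,k}) = Σ_{i≥d} (−1)^{i−d}·i!·C(k,i)·A_d(i,n)·h^i·P_{m+nd−i,k−i}`. -/
theorem stmt4 (R : Type*) [CommRing R] (h : R) (m k n d : ℕ) (hn : 1 ≤ n) (hd : 1 ≤ d) :
    (fun Y => -Pop R h n 0 * Y - Y * -Pop R h n 0)^[d] (Pop R h m k) =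
      ∑ i ∈ Finset.Icc d (k + n * d),
        ((-1 : ℤ) ^ (i - d) * (i.factorial : ℤ) * (k.choose i : ℤ) * (Acoef d i n : ℤ)) •
          (h ^ i • Pop R h (m + n * d - i) (k - i)) := by
  change (adm R h n)^[d] (Pop R h m k) = _
  rw [adm_iter]
  have h1 : ∀ i, i ∉ Finset.range (k + 1) → k.choose i = 0 := by
    intro i hi
    apply Nat.choose_eq_zero_of_lt
    simpa [Nat.lt_succ_iff] using hi
  rw [Finset.sum_subset (s₂ := Finset.range (k + n * d + 1))
    (by intro i; simp only [Finset.mem_range]; omega)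
    (by intro i _ hi; simp [h1 i hi])]
  symm
  rw [Finset.sum_subset (s₂ := Finset.range (k + n * d + 1))
    (by intro i; simp only [Finset.mem_range, Finset.mem_Icc]; omega)
    (by
      intro i hi hi'
      have : i < d := by
        simp only [Finset.mem_range, Finset.mem_Icc] at hi hi'
        omega
      simp [Acoef_lt d i n this])]
  apply Finset.sum_congr rfl
  intro i _
  by_cases hi : i < d
  · simp [Acoef_lt d i n hi]
  · obtain ⟨c, rfl⟩ := Nat.exists_eq_add_of_le (not_lt.1 hi)
    congr 4
    rw [Nat.add_sub_cancel_left, show d + c + d = c + 2 * d by ring, pow_add, pow_mul]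
    simp
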